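/- For every smooth compactly supported ψ: ℝ³ → ℂ⁴ and every m ≥ 0, the inequality (8/9) ∫_{ℝ³} |x| |(α·∇)ψ|² dx ≤ ∫_{ℝ³} |x| |(i α·∇ - mβ ± i)ψ|² dx holds, where α_k and β are the Dirac matrices. -/

import Mathlib

noncomputable section
open MeasureTheory Matrix Finset

abbrev E3 := EuclideanSpace ℝ (Fin 3)

/-- The Pauli matrices. -/
def pauli : Fin 3 → Matrix (Fin 2) (Fin 2) ℂ :=
  ![!![0, 1; 1, 0], !![0, -Complex.I; Complex.I, 0], !![1, 0; 0, -1]]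

/-- `σ · a` for a real vector `a`. -/
def sigmaDot (a : Fin 3 → ℝ) : Matrix (Fin 2) (Fin 2) ℂ :=
  ∑ k, (a k : ℂ) • pauli k

/-- `(σ · ∇)φ` for a `ℂ²`-valued function. -/
def sigmaGrad (φ : E3 → Fin 2 → ℂ) (x : E3) : Fin 2 → ℂ :=
  ∑ k, (pauli k).mulVec (fderiv ℝ φ x (EuclideanSpace.single k 1))

/-- The radial derivative `∂_r φ(x) = (x/|x|)·∇φ(x)`. -/
def radialDeriv {F : Type*} [NormedAddCommGroup F] [NormedSpace ℝ F]
    (φ : E3 → F) (x : E3) : F := fderiv ℝ φ x (‖x‖⁻¹ • x)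

/-- The Dirac matrices `α_k` in block form. -/
def diracAlpha (k : Fin 3) : Matrix (Fin 4) (Fin 4) ℂ :=
  Matrix.reindex finSumFinEquiv finSumFinEquiv ((Matrix.fromBlocks 0 (pauli k) (pauli k) 0 : Matrix (Fin 2 ⊕ Fin 2) (Fin 2 ⊕ Fin 2) ℂ))

/-- The Dirac matrix `β` in block form. -/
def diracBeta : Matrix (Fin 4) (Fin 4) ℂ :=
  Matrix.reindex finSumFinEquiv finSumFinEquiv ((Matrix.fromBlocks 1 0 0 (-1) : Matrix (Fin 2 ⊕ Fin 2) (Fin 2 ⊕ Fin 2) ℂ))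

/-- `(α · ∇)ψ` for a `ℂ⁴`-valued function. -/
def alphaGrad (ψ : E3 → Fin 4 → ℂ) (x : E3) : Fin 4 → ℂ :=
  ∑ k, (diracAlpha k).mulVec (fderiv ℝ ψ x (EuclideanSpace.single k 1))


/-- The integrable functions on `ℝ³` with vanishing integral, such as the divergences of compactly
supported vector fields. -/
structure IntegratesToZero (f : E3 → ℝ) : Prop where
  integrable : Integrable f
  integral_eq : ∫ x, f x = 0

namespace IntegratesToZero

variable {f g : E3 → ℝ}

theorem add (hf : IntegratesToZero f) (hg : IntegratesToZero g) :
    IntegratesToZero fun x => f x + g x :=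
  ⟨hf.integrable.add hg.integrable, by
    rw [integral_add hf.integrable hg.integrable, hf.integral_eq, hg.integral_eq, add_zero]⟩

theorem const_mul (hf : IntegratesToZero f) (c : ℝ) : IntegratesToZero fun x => c * f x :=
  ⟨hf.integrable.const_mul c, by rw [integral_const_mul, hf.integral_eq, mul_zero]⟩

theorem sub (hf : IntegratesToZero f) (hg : IntegratesToZero g) :
    IntegratesToZero fun x => f x - g x :=
  ⟨hf.integrable.sub hg.integrable, by
    rw [integral_sub hf.integrable hg.integrable, hf.integral_eq, hg.integral_eq, sub_zero]⟩

theorem sum {ι : Type*} (s : Finset ι) {F : ι → E3 → ℝ} (hF : ∀ i ∈ s, IntegratesToZero (F i)) :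
    IntegratesToZero fun x => ∑ i ∈ s, F i x :=
  ⟨integrable_finsetSum s fun i hi => (hF i hi).integrable, by
    rw [integral_finsetSum s fun i hi => (hF i hi).integrable]
    exact Finset.sum_eq_zero fun i hi => (hF i hi).integral_eq⟩

end IntegratesToZero

/-- The partial derivative of a real function on `ℝ³` in the direction of the `k`-th axis. -/
def partialDeriv (k : Fin 3) (f : E3 → ℝ) (x : E3) : ℝ :=
  fderiv ℝ f x (EuclideanSpace.single k 1)

theorem partialDeriv_mul {f g : E3 → ℝ} (hf : Differentiable ℝ f) (hg : Differentiable ℝ g)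
    (k : Fin 3) (x : E3) :
    partialDeriv k (fun y => f y * g y) x = partialDeriv k f x * g x + f x * partialDeriv k g x := by
  simp only [partialDeriv, fderiv_fun_mul (hf x) (hg x)]
  simp
  ring

theorem partialDeriv_sub {f g : E3 → ℝ} (hf : Differentiable ℝ f) (hg : Differentiable ℝ g)
    (k : Fin 3) (x : E3) :
    partialDeriv k (fun y => f y - g y) x = partialDeriv k f x - partialDeriv k g x := by
  simp only [partialDeriv, fderiv_fun_sub (hf x) (hg x)]
  simp

theorem partialDeriv_coord (k l : Fin 3) (x : E3) :
    partialDeriv k (fun y => y l) x = if l = k then 1 else 0 := by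
  have h : HasFDerivAt (fun y : E3 => y l) (EuclideanSpace.proj l : E3 →L[ℝ] ℝ) x :=
    (EuclideanSpace.proj l : E3 →L[ℝ] ℝ).hasFDerivAt
  simp [partialDeriv, h.fderiv]

theorem contDiff_coord (l : Fin 3) : ContDiff ℝ (⊤ : ℕ∞) fun y : E3 => y l :=
  (EuclideanSpace.proj l : E3 →L[ℝ] ℝ).contDiff

theorem ContDiff.partialDeriv {f : E3 → ℝ} (hf : ContDiff ℝ (⊤ : ℕ∞) f) (k : Fin 3) :
    ContDiff ℝ (⊤ : ℕ∞) (partialDeriv k f) :=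
  (hf.fderiv_right (by simp)).clm_apply contDiff_const

theorem HasCompactSupport.partialDeriv {f : E3 → ℝ} (hf : HasCompactSupport f) (k : Fin 3) :
    HasCompactSupport (partialDeriv k f) :=
  hf.fderiv_apply (𝕜 := ℝ) _

theorem partialDeriv_comm {f : E3 → ℝ} (hf : ContDiff ℝ (⊤ : ℕ∞) f) (k l : Fin 3) (x : E3) :
    partialDeriv k (partialDeriv l f) x = partialDeriv l (partialDeriv k f) x := by
  have hd : DifferentiableAt ℝ (fderiv ℝ f) x :=
    ((hf.fderiv_right (m := (⊤ : ℕ∞)) (by simp)).differentiable (by simp)) x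
  have key (i j : Fin 3) : partialDeriv i (partialDeriv j f) x =
      fderiv ℝ (fderiv ℝ f) x (EuclideanSpace.single i 1) (EuclideanSpace.single j 1) := by
    have h : HasFDerivAt (partialDeriv j f) _ x :=
      hd.hasFDerivAt.clm_apply (hasFDerivAt_const (EuclideanSpace.single j (1 : ℝ)) x)
    simp [partialDeriv, h.fderiv]
  rw [key, key]
  exact (hf.contDiffAt.isSymmSndFDerivAt (by
    rw [minSmoothness_of_isRCLikeNormedField]
    exact WithTop.coe_le_coe.2 (le_top : (2 : ℕ∞) ≤ ⊤))) _ _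

theorem integratesToZero_partialDeriv {g : E3 → ℝ} (hg : ContDiff ℝ (⊤ : ℕ∞) g)
    (hc : HasCompactSupport g) (k : Fin 3) : IntegratesToZero (partialDeriv k g) := by
  obtain ⟨D, hD⟩ := ContDiff.lipschitzWith_of_hasCompactSupport hc hg (by simp)
  refine ⟨(hg.partialDeriv k).continuous.integrable_of_hasCompactSupport (hc.partialDeriv k), ?_⟩
  have h := (LipschitzWith.const (1 : ℝ)).integral_lineDeriv_mul_eq (μ := volume) hD hc
    (-EuclideanSpace.single k (1 : ℝ) : E3)
  have h' : lineDeriv ℝ (fun _ : E3 => (1 : ℝ)) = 0 := by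
    ext; simp [lineDeriv]
  simpa [h', ((hg.differentiable (by simp)).differentiableAt).lineDeriv_eq_fderiv,
    partialDeriv] using h.symm

theorem lineDeriv_norm {x : E3} (hx : x ≠ 0) (k : Fin 3) :
    lineDeriv ℝ (fun y : E3 => ‖y‖) x (EuclideanSpace.single k 1) = x k / ‖x‖ := by
  have h := ((hasStrictFDerivAt_norm_sq x).hasFDerivAt.sqrt
    (pow_ne_zero 2 (norm_ne_zero_iff.2 hx)))
  simp only [Real.sqrt_sq (norm_nonneg _)] at h
  rw [h.differentiableAt.lineDeriv_eq_fderiv, h.fderiv]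
  simp [EuclideanSpace.inner_single_right]
  field_simp

theorem abs_coord_div_norm_le (x : E3) (k : Fin 3) : |x k / ‖x‖| ≤ 1 := by
  rw [abs_div, abs_norm]
  exact div_le_one_of_le₀ (PiLp.norm_apply_le x k) (norm_nonneg x)

/-- The divergence of `‖x‖ g(x) e_k` integrates to zero. -/
theorem integratesToZero_norm_mul {g : E3 → ℝ} (hg : ContDiff ℝ (⊤ : ℕ∞) g)
    (hc : HasCompactSupport g) (k : Fin 3) :
    IntegratesToZero fun x => x k / ‖x‖ * g x + ‖x‖ * partialDeriv k g x := by
  obtain ⟨D, hD⟩ := ContDiff.lipschitzWith_of_hasCompactSupport hc hg (by simp)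
  have hi : Integrable fun x => x k / ‖x‖ * g x :=
    (hg.continuous.integrable_of_hasCompactSupport hc).bdd_mul (c := 1)
      (((contDiff_coord k).continuous.measurable.div measurable_norm).aestronglyMeasurable)
      (Filter.Eventually.of_forall fun x => abs_coord_div_norm_le x k)
  have hi' : Integrable fun x => ‖x‖ * partialDeriv k g x :=
    (continuous_norm.mul (hg.partialDeriv k).continuous).integrable_of_hasCompactSupport
      (hc.partialDeriv k).mul_left
  refine ⟨hi.add hi', ?_⟩
  have h := lipschitzWith_one_norm.integral_lineDeriv_mul_eq (μ := volume) hD hc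
    (EuclideanSpace.single k (1 : ℝ) : E3)
  have h0 : ∀ᵐ x : E3, x ≠ 0 := Measure.ae_ne volume 0
  rw [integral_congr_ae (g := fun x => x k / ‖x‖ * g x)
    (h0.mono fun x hx => by simp only [lineDeriv_norm hx])] at h
  rw [integral_add hi hi', h, ← integral_add _ hi']
  · refine integral_eq_zero_of_ae (Filter.Eventually.of_forall fun x => ?_)
    simp [((hg.differentiable (by simp)).differentiableAt).lineDeriv_eq_fderiv, partialDeriv]
    ring
  · refine hi'.neg.congr (Filter.Eventually.of_forall fun x => ?_)
    simp [((hg.differentiable (by simp)).differentiableAt).lineDeriv_eq_fderiv, partialDeriv]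
    ring

/-- The component `(x × y)_k` of the cross product, with indices modulo `3`. -/
def crossComp (x y : Fin 3 → ℝ) (k : Fin 3) : ℝ := x (k + 1) * y (k + 2) - x (k + 2) * y (k + 1)

/-- `(δ + n ⊗ n) w`, with components indexed by `k`. -/
def reflectComp (n w : Fin 3 → ℝ) (k : Fin 3) : ℝ := w k + n k * ∑ l, n l * w l

/-- The components of the cross product `∇f × ∇g`. -/
def gradCross (f g : E3 → ℝ) (q : Fin 3) (x : E3) : ℝ :=
  crossComp (fun k => partialDeriv k f x) (fun k => partialDeriv k g x) q

theorem contDiff_gradCross {f g : E3 → ℝ} (hf : ContDiff ℝ (⊤ : ℕ∞) f)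
    (hg : ContDiff ℝ (⊤ : ℕ∞) g) (q : Fin 3) : ContDiff ℝ (⊤ : ℕ∞) (gradCross f g q) :=
  ((hf.partialDeriv _).mul (hg.partialDeriv _)).sub ((hf.partialDeriv _).mul (hg.partialDeriv _))

theorem hasCompactSupport_gradCross {f g : E3 → ℝ} (hf : HasCompactSupport f) (q : Fin 3) :
    HasCompactSupport (gradCross f g q) :=
  (hf.partialDeriv _).mul_right.sub (hf.partialDeriv _).mul_right

theorem sum_partialDeriv_gradCross {f g : E3 → ℝ} (hf : ContDiff ℝ (⊤ : ℕ∞) f)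
    (hg : ContDiff ℝ (⊤ : ℕ∞) g) (x : E3) :
    ∑ q, partialDeriv q (gradCross f g q) x = 0 := by
  have hF (k : Fin 3) := (hf.partialDeriv k).differentiable (by simp)
  have hG (k : Fin 3) := (hg.partialDeriv k).differentiable (by simp)
  have key (q : Fin 3) : partialDeriv q (gradCross f g q) x = _ :=
    partialDeriv_sub ((hF (q + 1)).mul (hG (q + 2))) ((hF (q + 2)).mul (hG (q + 1))) q x
  simp only [key, Pi.mul_def, partialDeriv_mul (hF _) (hG _), Fin.sum_univ_three]
  simp only [Fin.isValue, zero_add, Fin.reduceAdd, partialDeriv_comm hf 1 0,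
    partialDeriv_comm hf 2 0, partialDeriv_comm hf 2 1, partialDeriv_comm hg 1 0,
    partialDeriv_comm hg 2 0, partialDeriv_comm hg 2 1]
  ring

/-- The Jacobian determinant of `(‖x‖ x_p, f, g)` integrates to zero. -/
theorem integratesToZero_jacobian {f g : E3 → ℝ} (hf : ContDiff ℝ (⊤ : ℕ∞) f)
    (hg : ContDiff ℝ (⊤ : ℕ∞) g) (hc : HasCompactSupport f) (p : Fin 3) :
    IntegratesToZero fun x =>
      ‖x‖ * reflectComp (fun k => x k / ‖x‖) (fun q => gradCross f g q x) p := by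
  have h := IntegratesToZero.sum univ fun q _ =>
    integratesToZero_norm_mul ((contDiff_coord p).mul (contDiff_gradCross hf hg q))
      (hasCompactSupport_gradCross hc q).mul_left q
  convert h using 2 with x
  have hC (q : Fin 3) := (contDiff_gradCross hf hg q).differentiable (by simp)
  simp only [partialDeriv_mul ((contDiff_coord p).differentiable (by simp)) (hC _),
    partialDeriv_coord, Finset.sum_add_distrib, ← Finset.mul_sum, ite_mul, one_mul, zero_mul,
    Finset.sum_ite_eq, Finset.mem_univ, if_true, sum_partialDeriv_gradCross hf hg]
  rcases eq_or_ne x 0 with rfl | hx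
  · simp [reflectComp]
  · have hr := norm_ne_zero_iff.2 hx
    simp only [reflectComp, mul_add, Finset.mul_sum, mul_zero, add_zero]
    rw [add_comm]
    congr 1
    refine Finset.sum_congr rfl fun q _ => ?_
    field_simp

/-- The divergence of `‖x‖ f(x) g(x) e_k` integrates to zero. -/
theorem integratesToZero_norm_mul_mul {f g : E3 → ℝ} (hf : ContDiff ℝ (⊤ : ℕ∞) f)
    (hg : ContDiff ℝ (⊤ : ℕ∞) g) (hc : HasCompactSupport f) (k : Fin 3) :
    IntegratesToZero fun x => x k / ‖x‖ * (f x * g x) +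
      ‖x‖ * (partialDeriv k f x * g x + f x * partialDeriv k g x) := by
  have h := integratesToZero_norm_mul (hf.mul hg) hc.mul_right k
  simpa only [partialDeriv_mul (hf.differentiable (by simp)) (hg.differentiable (by simp))] using h

/-- The divergence of `f(x)² x` integrates to zero. -/
theorem integratesToZero_sq_mul_coord {f : E3 → ℝ} (hf : ContDiff ℝ (⊤ : ℕ∞) f)
    (hc : HasCompactSupport f) :
    IntegratesToZero fun x => 3 * f x ^ 2 + 2 * ∑ k, x k * (f x * partialDeriv k f x) := by
  have h := IntegratesToZero.sum univ fun k _ =>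
    integratesToZero_partialDeriv ((contDiff_coord k).mul (hf.mul hf)) (hc.mul_right.mul_left) k
  convert h using 1
  funext x
  have hd := hf.differentiable (by simp)
  have hd' : Differentiable ℝ fun y => f y * f y := hd.mul hd
  simp only [partialDeriv_mul ((contDiff_coord _).differentiable (by simp)) hd',
    partialDeriv_mul hd hd, partialDeriv_coord, Fin.sum_univ_three, if_true]
  ring

/-- If `n · a = 0` for a unit vector `n` and spinors `a₁, a₂, a₃`, with
`a_k = (p k + i q k, s k + i t k)`, then `|σ · a|² ≤ 2 |a|²`. -/
theorem sq_sigma_le_of_tangential (n p q s t : Fin 3 → ℝ)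
    (hn : n 0 ^ 2 + n 1 ^ 2 + n 2 ^ 2 = 1)
    (hp : n 0 * p 0 + n 1 * p 1 + n 2 * p 2 = 0) (hq : n 0 * q 0 + n 1 * q 1 + n 2 * q 2 = 0)
    (hs : n 0 * s 0 + n 1 * s 1 + n 2 * s 2 = 0) (ht : n 0 * t 0 + n 1 * t 1 + n 2 * t 2 = 0) :
    (s 0 + t 1 + p 2) ^ 2 + (t 0 - s 1 + q 2) ^ 2 + (p 0 - q 1 - s 2) ^ 2 +
      (q 0 + p 1 - t 2) ^ 2 ≤
      2 * ∑ k, (p k ^ 2 + q k ^ 2 + s k ^ 2 + t k ^ 2) := by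
  simp only [Fin.sum_univ_three]
  obtain ⟨a, ha⟩ : ∃ a, a = s 0 + t 1 + p 2 := ⟨_, rfl⟩
  obtain ⟨b, hb⟩ : ∃ b, b = t 0 - s 1 + q 2 := ⟨_, rfl⟩
  obtain ⟨c, hc⟩ : ∃ c, c = p 0 - q 1 - s 2 := ⟨_, rfl⟩
  obtain ⟨d, hd⟩ : ∃ d, d = q 0 + p 1 - t 2 := ⟨_, rfl⟩
  obtain ⟨a', ha'⟩ : ∃ a', a' = n 0 * c + n 1 * d + n 2 * a := ⟨_, rfl⟩
  obtain ⟨b', hb'⟩ : ∃ b', b' = n 0 * d - n 1 * c + n 2 * b := ⟨_, rfl⟩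
  obtain ⟨c', hc'⟩ : ∃ c', c' = n 0 * a - n 1 * b - n 2 * c := ⟨_, rfl⟩
  obtain ⟨d', hd'⟩ : ∃ d', d' = n 0 * b + n 1 * a - n 2 * d := ⟨_, rfl⟩
  have hnorm : a' ^ 2 + b' ^ 2 + c' ^ 2 + d' ^ 2 = a ^ 2 + b ^ 2 + c ^ 2 + d ^ 2 := by
    subst ha' hb' hc' hd'
    linear_combination (a ^ 2 + b ^ 2 + c ^ 2 + d ^ 2) * hn
  have key : 0 ≤ (2 * p 0 - c + n 0 * a') ^ 2 + (2 * q 0 - d + n 0 * b') ^ 2 +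
      (2 * s 0 - a + n 0 * c') ^ 2 + (2 * t 0 - b + n 0 * d') ^ 2 +
      ((2 * p 1 - d + n 1 * a') ^ 2 + (2 * q 1 + c + n 1 * b') ^ 2 +
      (2 * s 1 + b + n 1 * c') ^ 2 + (2 * t 1 - a + n 1 * d') ^ 2) +
      ((2 * p 2 - a + n 2 * a') ^ 2 + (2 * q 2 - b + n 2 * b') ^ 2 +
      (2 * s 2 + c + n 2 * c') ^ 2 + (2 * t 2 + d + n 2 * d') ^ 2) := by positivity
  rw [← ha, ← hb, ← hc, ← hd]
  linear_combination (1 / 2) * key +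
    (1 / 2) * (a' ^ 2 + b' ^ 2 + c' ^ 2 + d' ^ 2) * hn - (1 / 2) * hnorm
    + 2 * a' * hp + 2 * b' * hq + 2 * c' * hs + 2 * d' * ht + 2 * a * ha + 2 * b * hb
    + 2 * c * hc + 2 * d * hd + a' * ha' + b' * hb' + c' * hc' + d' * hd'

/-- The pointwise form of `∫ |x| |∂_r φ|² ≤ ∫ |x| |(σ · ∇) φ|²`, in which the terms on the left
built from cross products are null Lagrangians. -/
theorem sq_radial_add_null_le_sq_sigma (n p q s t : Fin 3 → ℝ)
    (hn : n 0 ^ 2 + n 1 ^ 2 + n 2 ^ 2 = 1) :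
    (∑ k, n k * p k) ^ 2 + (∑ k, n k * q k) ^ 2 + (∑ k, n k * s k) ^ 2 + (∑ k, n k * t k) ^ 2 -
      2 * (reflectComp n (crossComp p t) 0 + reflectComp n (crossComp s q) 0 -
        reflectComp n (crossComp p s) 1 - reflectComp n (crossComp q t) 1 +
        reflectComp n (crossComp p q) 2 - reflectComp n (crossComp s t) 2) ≤
      (s 0 + t 1 + p 2) ^ 2 + (t 0 - s 1 + q 2) ^ 2 + (p 0 - q 1 - s 2) ^ 2 +
      (q 0 + p 1 - t 2) ^ 2 := by
  have h := sq_sigma_le_of_tangential n (crossComp n p) (crossComp n q) (crossComp n s)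
    (crossComp n t) hn (by simp [crossComp]; ring) (by simp [crossComp]; ring)
    (by simp [crossComp]; ring) (by simp [crossComp]; ring)
  simp only [crossComp, reflectComp, Fin.sum_univ_three, Fin.isValue, zero_add, Fin.reduceAdd]
    at h ⊢
  linear_combination h + ((s 0 + t 1 + p 2) ^ 2 + (t 0 - s 1 + q 2) ^ 2 +
      (p 0 - q 1 - s 2) ^ 2 + (q 0 + p 1 - t 2) ^ 2 +
      2 * ((p 1 * t 2 - p 2 * t 1) + (s 1 * q 2 - s 2 * q 1) - (p 2 * s 0 - p 0 * s 2) -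
        (q 2 * t 0 - q 0 * t 2) + (p 0 * q 1 - p 1 * q 0) - (s 0 * t 1 - s 1 * t 0))) * hn

/-- The null Lagrangian of a spinor field with real components `p + i q, s + i t` integrates to
zero. -/
theorem integratesToZero_spinor {p q s t : E3 → ℝ} (hp : ContDiff ℝ (⊤ : ℕ∞) p)
    (hq : ContDiff ℝ (⊤ : ℕ∞) q) (hs : ContDiff ℝ (⊤ : ℕ∞) s) (ht : ContDiff ℝ (⊤ : ℕ∞) t)
    (hcp : HasCompactSupport p) (hcq : HasCompactSupport q) (hcs : HasCompactSupport s) :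
    IntegratesToZero fun x =>
      ‖x‖ * reflectComp (fun k => x k / ‖x‖) (fun l => gradCross p t l x) 0 +
      ‖x‖ * reflectComp (fun k => x k / ‖x‖) (fun l => gradCross s q l x) 0 -
      ‖x‖ * reflectComp (fun k => x k / ‖x‖) (fun l => gradCross p s l x) 1 -
      ‖x‖ * reflectComp (fun k => x k / ‖x‖) (fun l => gradCross q t l x) 1 +
      ‖x‖ * reflectComp (fun k => x k / ‖x‖) (fun l => gradCross p q l x) 2 -
      ‖x‖ * reflectComp (fun k => x k / ‖x‖) (fun l => gradCross s t l x) 2 :=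
  (((((integratesToZero_jacobian hp ht hcp 0).add (integratesToZero_jacobian hs hq hcs 0)).sub
    (integratesToZero_jacobian hp hs hcp 1)).sub (integratesToZero_jacobian hq ht hcq 1)).add
    (integratesToZero_jacobian hp hq hcp 2)).sub (integratesToZero_jacobian hs ht hcs 2)

/-- The integrand of `integratesToZero_norm_mul_mul`. -/
def normDiv (k : Fin 3) (f g : E3 → ℝ) (x : E3) : ℝ :=
  x k / ‖x‖ * (f x * g x) + ‖x‖ * (partialDeriv k f x * g x + f x * partialDeriv k g x)

/-- The divergence of `‖x‖ Re ⟨χ, σ_k φ⟩ e_k`, where `u + i v = (φ, χ)`. -/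
def reDiv (u v : Fin 4 → E3 → ℝ) (x : E3) : ℝ :=
  (normDiv 0 (u 2) (u 1) x + normDiv 0 (v 2) (v 1) x + normDiv 0 (u 3) (u 0) x +
    normDiv 0 (v 3) (v 0) x) +
  (normDiv 1 (u 2) (v 1) x - normDiv 1 (v 2) (u 1) x - normDiv 1 (u 3) (v 0) x +
    normDiv 1 (v 3) (u 0) x) +
  (normDiv 2 (u 2) (u 0) x + normDiv 2 (v 2) (v 0) x - normDiv 2 (u 3) (u 1) x -
    normDiv 2 (v 3) (v 1) x)

/-- The divergence of `‖x‖ Im ⟨χ, σ_k φ⟩ e_k`, where `u + i v = (φ, χ)`. -/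
def imDiv (u v : Fin 4 → E3 → ℝ) (x : E3) : ℝ :=
  (normDiv 0 (u 2) (v 1) x - normDiv 0 (v 2) (u 1) x + normDiv 0 (u 3) (v 0) x -
    normDiv 0 (v 3) (u 0) x) +
  (normDiv 1 (u 3) (u 0) x + normDiv 1 (v 3) (v 0) x - normDiv 1 (u 2) (u 1) x -
    normDiv 1 (v 2) (v 1) x) +
  (normDiv 2 (u 2) (v 0) x - normDiv 2 (v 2) (u 0) x - normDiv 2 (u 3) (v 1) x +
    normDiv 2 (v 3) (u 1) x)

theorem integratesToZero_reDiv {u v : Fin 4 → E3 → ℝ}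
    (hu : ∀ i, ContDiff ℝ (⊤ : ℕ∞) (u i)) (hv : ∀ i, ContDiff ℝ (⊤ : ℕ∞) (v i))
    (hcu : ∀ i, HasCompactSupport (u i)) (hcv : ∀ i, HasCompactSupport (v i)) :
    IntegratesToZero (reDiv u v) := by
  have huu (k i j) : IntegratesToZero (normDiv k (u i) (u j)) :=
    integratesToZero_norm_mul_mul (hu i) (hu j) (hcu i) k
  have huv (k i j) : IntegratesToZero (normDiv k (u i) (v j)) :=
    integratesToZero_norm_mul_mul (hu i) (hv j) (hcu i) k
  have hvu (k i j) : IntegratesToZero (normDiv k (v i) (u j)) :=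
    integratesToZero_norm_mul_mul (hv i) (hu j) (hcv i) k
  have hvv (k i j) : IntegratesToZero (normDiv k (v i) (v j)) :=
    integratesToZero_norm_mul_mul (hv i) (hv j) (hcv i) k
  exact (((((huu 0 2 1).add (hvv 0 2 1)).add (huu 0 3 0)).add (hvv 0 3 0)).add
    ((((huv 1 2 1).sub (hvu 1 2 1)).sub (huv 1 3 0)).add (hvu 1 3 0))).add
    ((((huu 2 2 0).add (hvv 2 2 0)).sub (huu 2 3 1)).sub (hvv 2 3 1))

theorem integratesToZero_imDiv {u v : Fin 4 → E3 → ℝ}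
    (hu : ∀ i, ContDiff ℝ (⊤ : ℕ∞) (u i)) (hv : ∀ i, ContDiff ℝ (⊤ : ℕ∞) (v i))
    (hcu : ∀ i, HasCompactSupport (u i)) (hcv : ∀ i, HasCompactSupport (v i)) :
    IntegratesToZero (imDiv u v) := by
  have huu (k i j) : IntegratesToZero (normDiv k (u i) (u j)) :=
    integratesToZero_norm_mul_mul (hu i) (hu j) (hcu i) k
  have huv (k i j) : IntegratesToZero (normDiv k (u i) (v j)) :=
    integratesToZero_norm_mul_mul (hu i) (hv j) (hcu i) k
  have hvu (k i j) : IntegratesToZero (normDiv k (v i) (u j)) :=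
    integratesToZero_norm_mul_mul (hv i) (hu j) (hcv i) k
  have hvv (k i j) : IntegratesToZero (normDiv k (v i) (v j)) :=
    integratesToZero_norm_mul_mul (hv i) (hv j) (hcv i) k
  exact (((((huv 0 2 1).sub (hvu 0 2 1)).add (huv 0 3 0)).sub (hvu 0 3 0)).add
    ((((huu 1 3 0).add (hvv 1 3 0)).sub (huu 1 2 1)).sub (hvv 1 2 1))).add
    ((((huv 2 2 0).sub (hvu 2 2 0)).sub (huv 2 3 1)).add (hvu 2 3 1))

/-- `2 Re ((s + i m) ⟨χ, (σ · n) φ⟩) ≤ μ (|φ|² + |χ|²)` when `|n| = 1`, `|s + i m| = μ` and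
`u + i v = (φ, χ)`. -/
theorem re_inner_sigma_le (n : Fin 3 → ℝ) (u v : Fin 4 → ℝ) {m s μ : ℝ} (hμ : 0 < μ)
    (hsm : s ^ 2 + m ^ 2 = μ ^ 2) (hn : n 0 ^ 2 + n 1 ^ 2 + n 2 ^ 2 = 1) :
    2 * s * (n 0 * (u 2 * u 1 + v 2 * v 1 + u 3 * u 0 + v 3 * v 0) +
        n 1 * (u 2 * v 1 - v 2 * u 1 - u 3 * v 0 + v 3 * u 0) +
        n 2 * (u 2 * u 0 + v 2 * v 0 - u 3 * u 1 - v 3 * v 1)) -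
      2 * m * (n 0 * (u 2 * v 1 - v 2 * u 1 + u 3 * v 0 - v 3 * u 0) +
        n 1 * (u 3 * u 0 + v 3 * v 0 - u 2 * u 1 - v 2 * v 1) +
        n 2 * (u 2 * v 0 - v 2 * u 0 - u 3 * v 1 + v 3 * u 1)) ≤
      μ * ∑ i, (u i ^ 2 + v i ^ 2) := by
  refine le_of_mul_le_mul_left ?_ hμ
  simp only [Fin.sum_univ_four]
  obtain ⟨a, ha⟩ : ∃ a, a = n 2 * u 0 + n 0 * u 1 + n 1 * v 1 := ⟨_, rfl⟩
  obtain ⟨b, hb⟩ : ∃ b, b = n 2 * v 0 + n 0 * v 1 - n 1 * u 1 := ⟨_, rfl⟩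
  obtain ⟨c, hc⟩ : ∃ c, c = n 0 * u 0 - n 1 * v 0 - n 2 * u 1 := ⟨_, rfl⟩
  obtain ⟨d, hd⟩ : ∃ d, d = n 0 * v 0 + n 1 * u 0 - n 2 * v 1 := ⟨_, rfl⟩
  have hnorm : a ^ 2 + b ^ 2 + c ^ 2 + d ^ 2 = u 0 ^ 2 + v 0 ^ 2 + u 1 ^ 2 + v 1 ^ 2 := by
    subst ha hb hc hd
    linear_combination (u 0 ^ 2 + v 0 ^ 2 + u 1 ^ 2 + v 1 ^ 2) * hn
  have key : 0 ≤ (μ * u 2 - (s * a - m * b)) ^ 2 + (μ * v 2 - (s * b + m * a)) ^ 2 +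
      (μ * u 3 - (s * c - m * d)) ^ 2 + (μ * v 3 - (s * d + m * c)) ^ 2 := by positivity
  linear_combination key + (a ^ 2 + b ^ 2 + c ^ 2 + d ^ 2) * hsm + μ ^ 2 * hnorm -
    2 * μ * (s * u 2 + m * v 2) * ha - 2 * μ * (s * v 2 - m * u 2) * hb -
    2 * μ * (s * u 3 + m * v 3) * hc - 2 * μ * (s * v 3 - m * u 3) * hd

theorem diracAlpha_zero :
    diracAlpha 0 = !![0, 0, 0, 1; 0, 0, 1, 0; 0, 1, 0, 0; 1, 0, 0, 0] := by
  ext i j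
  fin_cases i <;> fin_cases j <;> rfl

theorem diracAlpha_one :
    diracAlpha 1 = !![0, 0, 0, -Complex.I; 0, 0, Complex.I, 0; 0, -Complex.I, 0, 0;
      Complex.I, 0, 0, 0] := by
  ext i j
  fin_cases i <;> fin_cases j <;> rfl

theorem diracAlpha_two :
    diracAlpha 2 = !![0, 0, 1, 0; 0, 0, 0, -1; 1, 0, 0, 0; 0, -1, 0, 0] := by
  ext i j
  fin_cases i <;> fin_cases j <;> rfl

theorem diracBeta_eq : diracBeta = Matrix.diagonal ![1, 1, -1, -1] := by
  ext i j
  fin_cases i <;> fin_cases j <;>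
    simp [diracBeta, finSumFinEquiv, Fin.addCases]

theorem fderiv_apply_component {ψ : E3 → Fin 4 → ℂ} (hψ : Differentiable ℝ ψ) (x w : E3)
    (i : Fin 4) : fderiv ℝ ψ x w i =
      ⟨fderiv ℝ (fun y => (ψ y i).re) x w, fderiv ℝ (fun y => (ψ y i).im) x w⟩ := by
  have h : HasFDerivAt (fun y => ψ y i) _ x := (hasFDerivAt_pi'.1 (hψ x).hasFDerivAt) i
  have hre : HasFDerivAt (fun y => (ψ y i).re) _ x := Complex.reCLM.hasFDerivAt.comp x h
  have him : HasFDerivAt (fun y => (ψ y i).im) _ x := Complex.imCLM.hasFDerivAt.comp x h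
  rw [hre.fderiv, him.fderiv]
  rfl

/-- The components of `(α · ∇)ψ` in terms of the real and imaginary parts of `ψ`. -/
theorem alphaGrad_eq {ψ : E3 → Fin 4 → ℂ} (hψ : Differentiable ℝ ψ) (x : E3)
    {a b : Fin 4 → Fin 3 → ℝ} (ha : ∀ i k, a i k = partialDeriv k (fun y => (ψ y i).re) x)
    (hb : ∀ i k, b i k = partialDeriv k (fun y => (ψ y i).im) x) :
    alphaGrad ψ x =
      ![⟨a 3 0 + b 3 1 + a 2 2, b 3 0 - a 3 1 + b 2 2⟩,
        ⟨a 2 0 - b 2 1 - a 3 2, b 2 0 + a 2 1 - b 3 2⟩,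
        ⟨a 1 0 + b 1 1 + a 0 2, b 1 0 - a 1 1 + b 0 2⟩,
        ⟨a 0 0 - b 0 1 - a 1 2, b 0 0 + a 0 1 - b 1 2⟩] := by
  have key (k : Fin 3) (i : Fin 4) :
      fderiv ℝ ψ x (EuclideanSpace.single k 1) i = ⟨a i k, b i k⟩ := by
    rw [fderiv_apply_component hψ, ha, hb]
    rfl
  ext i
  simp only [alphaGrad, Fin.sum_univ_three, diracAlpha_zero, diracAlpha_one, diracAlpha_two]
  fin_cases i <;> apply Complex.ext <;>
    simp [dotProduct, Fin.sum_univ_four, key] <;> ring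

theorem sq_norm_eq_re_im (z : ℂ) : ‖z‖ ^ 2 = z.re ^ 2 + z.im ^ 2 := by
  rw [Complex.sq_norm, Complex.normSq_apply]
  ring

theorem continuous_alphaGrad {ψ : E3 → Fin 4 → ℂ} (hψ : ContDiff ℝ (⊤ : ℕ∞) ψ) :
    Continuous (alphaGrad ψ) := by
  have h := hψ.continuous_fderiv (by simp)
  unfold alphaGrad
  fun_prop

theorem alphaGrad_eq_zero_of_notMem_tsupport {ψ : E3 → Fin 4 → ℂ} {x : E3}
    (hx : x ∉ tsupport ψ) : alphaGrad ψ x = 0 := by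
  simp [alphaGrad, fderiv_of_notMem_tsupport (𝕜 := ℝ) hx]

theorem stmt13 (ψ : E3 → Fin 4 → ℂ) (hψ : ContDiff ℝ (⊤ : ℕ∞) ψ) (hc : HasCompactSupport ψ)
    (m : ℝ) (hm : 0 ≤ m) (s : ℝ) (hs : s = 1 ∨ s = -1) :
    8 / 9 * (∫ x : E3, ‖x‖ * ∑ i, ‖alphaGrad ψ x i‖ ^ 2) ≤
      ∫ x : E3, ‖x‖ * ∑ i,
        ‖Complex.I * alphaGrad ψ x i - (m : ℂ) * diracBeta.mulVec (ψ x) i +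
          (s : ℂ) * Complex.I * ψ x i‖ ^ 2 := by
  have hcont := continuous_alphaGrad hψ
  have hψc := hψ.continuous
  have hL : Integrable fun x : E3 => ‖x‖ * ∑ i, ‖alphaGrad ψ x i‖ ^ 2 := by
    refine Continuous.integrable_of_hasCompactSupport (by fun_prop) (.intro hc fun x hx => ?_)
    simp [alphaGrad_eq_zero_of_notMem_tsupport hx]
  have hR : Integrable fun x : E3 => ‖x‖ * ∑ i,
      ‖Complex.I * alphaGrad ψ x i - (m : ℂ) * diracBeta.mulVec (ψ x) i +
        (s : ℂ) * Complex.I * ψ x i‖ ^ 2 := by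
    refine Continuous.integrable_of_hasCompactSupport (by fun_prop) (.intro hc fun x hx => ?_)
    simp [alphaGrad_eq_zero_of_notMem_tsupport hx, image_eq_zero_of_notMem_tsupport hx]
  obtain ⟨μ, hμ, hsm⟩ : ∃ μ : ℝ, 0 < μ ∧ s ^ 2 + m ^ 2 = μ ^ 2 := by
    refine ⟨√(1 + m ^ 2), by positivity, ?_⟩
    rw [Real.sq_sqrt (by positivity)]
    rcases hs with rfl | rfl <;> ring
  obtain ⟨u, hu_eq⟩ : ∃ u : Fin 4 → E3 → ℝ, u = fun i y => (ψ y i).re := ⟨_, rfl⟩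
  obtain ⟨v, hv_eq⟩ : ∃ v : Fin 4 → E3 → ℝ, v = fun i y => (ψ y i).im := ⟨_, rfl⟩
  have hu (i) : ContDiff ℝ (⊤ : ℕ∞) (u i) := by
    rw [hu_eq]; exact Complex.reCLM.contDiff.comp (contDiff_pi.1 hψ i)
  have hv (i) : ContDiff ℝ (⊤ : ℕ∞) (v i) := by
    rw [hv_eq]; exact Complex.imCLM.contDiff.comp (contDiff_pi.1 hψ i)
  have hcu (i) : HasCompactSupport (u i) := by
    rw [hu_eq]; exact hc.comp_left (g := fun z : Fin 4 → ℂ => (z i).re) rfl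
  have hcv (i) : HasCompactSupport (v i) := by
    rw [hv_eq]; exact hc.comp_left (g := fun z : Fin 4 → ℂ => (z i).im) rfl
  have hnull := ((((integratesToZero_reDiv hu hv hcu hcv).const_mul (2 * s)).sub
    ((integratesToZero_imDiv hu hv hcu hcv).const_mul (2 * m))).sub
    (((integratesToZero_spinor (hu 0) (hv 0) (hu 1) (hv 1) (hcu 0) (hcv 0) (hcu 1)).add
      (integratesToZero_spinor (hu 2) (hv 2) (hu 3) (hv 3) (hcu 2) (hcv 2)
        (hcu 3))).const_mul (2 / 9))).sub
    ((IntegratesToZero.sum univ fun i _ =>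
      (integratesToZero_sq_mul_coord (hu i) (hcu i)).add
        (integratesToZero_sq_mul_coord (hv i) (hcv i))).const_mul (μ / 3))
  rw [← add_zero (8 / 9 * _), ← hnull.integral_eq, ← integral_const_mul,
    ← integral_add (hL.const_mul _) hnull.integrable]
  refine integral_mono_ae ((hL.const_mul _).add hnull.integrable) hR ?_
  filter_upwards [Measure.ae_ne volume (0 : E3)] with x hx
  obtain ⟨a, ha⟩ : ∃ a : Fin 4 → Fin 3 → ℝ, ∀ i k, a i k = partialDeriv k (u i) x :=
    ⟨_, fun _ _ => rfl⟩
  obtain ⟨b, hb⟩ : ∃ b : Fin 4 → Fin 3 → ℝ, ∀ i k, b i k = partialDeriv k (v i) x :=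
    ⟨_, fun _ _ => rfl⟩
  have hD := alphaGrad_eq (hψ.differentiable (by simp)) x (a := a) (b := b)
    (by simpa [hu_eq] using ha) (by simpa [hv_eq] using hb)
  have hr : 0 < ‖x‖ := norm_pos_iff.2 hx
  obtain ⟨n, hn_eq⟩ : ∃ n : Fin 3 → ℝ, ∀ k, n k = x k / ‖x‖ := ⟨_, fun _ => rfl⟩
  have hxn (k) : x k = ‖x‖ * n k := by rw [hn_eq]; field_simp
  have hn : n 0 ^ 2 + n 1 ^ 2 + n 2 ^ 2 = 1 := by
    have h := EuclideanSpace.real_norm_sq_eq x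
    rw [Fin.sum_univ_three, hxn 0, hxn 1, hxn 2] at h
    have h2 : ‖x‖ ^ 2 ≠ 0 := by positivity
    field_simp at h
    linarith
  have hupper := sq_radial_add_null_le_sq_sigma n (a 0) (b 0) (a 1) (b 1) hn
  have hlower := sq_radial_add_null_le_sq_sigma n (a 2) (b 2) (a 3) (b 3) hn
  have hzero := re_inner_sigma_le n (fun i => u i x) (fun i => v i x) hμ hsm hn
  have hsq : 0 ≤ ‖x‖ * ∑ i, ((∑ k, n k * a i k + 3 * μ * u i x) ^ 2 +
      (∑ k, n k * b i k + 3 * μ * v i x) ^ 2) := by positivity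
  have hψuv (i) : ψ x i = ⟨u i x, v i x⟩ := by rw [hu_eq, hv_eq]
  replace hupper := mul_le_mul_of_nonneg_left hupper hr.le
  replace hlower := mul_le_mul_of_nonneg_left hlower hr.le
  simp only [reDiv, imDiv, normDiv, gradCross, ← ha, ← hb, ← hn_eq]
  simp only [hxn]
  rw [hD]
  simp only [sq_norm_eq_re_im, diracBeta_eq, Matrix.mulVec_diagonal, hψuv,
    Fin.sum_univ_four, Fin.sum_univ_three] at hsq hupper hlower hzero ⊢
  simp only [Complex.add_re, Complex.add_im, Complex.sub_re, Complex.sub_im, Complex.mul_re,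
    Complex.mul_im, Complex.I_re, Complex.I_im, Complex.ofReal_re, Complex.ofReal_im,
    Complex.one_re, Complex.one_im, Complex.neg_re, Complex.neg_im, Matrix.cons_val]
  linear_combination (1 / 9) * hupper + (1 / 9) * hlower + (1 / 9) * hsq + hzero -
    ‖x‖ * (u 0 x ^ 2 + v 0 x ^ 2 + u 1 x ^ 2 + v 1 x ^ 2 + u 2 x ^ 2 + v 2 x ^ 2 +
      u 3 x ^ 2 + v 3 x ^ 2) * hsm
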